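/- There exists a universal constant C > 0 such that the following holds for all integers n1 ≥ 2, n2 ≥ 2 and every integer k ≥ 1. Define Φ ∈ ℝ^{(n1-1)×(n2-1)} by Φ_{i,j} = √(log n1 · log n2) · min{ (√i ∧ √(n1 - i)) (√j ∧ √(n2 - j)), √(n1 n2 / k) }, where a ∧ b denotes min{a, b}. Then ‖ Dᵀ Φ D̃ ‖_F² ≤ C ( log n1 · log n2 · √(n1 n2 / k) + (log n1)² (log n2)² ). -/

import Mathlib

open Matrix Real

noncomputable section

/-- The first-order difference matrix `D ∈ ℝ^{(n-1)×n}` (here with `n = m+2`). -/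
def diffMat (m : ℕ) : Matrix (Fin (m+1)) (Fin (m+2)) ℝ :=
  Matrix.of fun i j => if j = i.castSucc then -1 else if j = i.succ then 1 else 0

/-- Squared Frobenius norm. -/
def frobSq {a b : ℕ} (M : Matrix (Fin a) (Fin b) ℝ) : ℝ := ∑ i, ∑ j, (M i j) ^ 2

/-- The weight matrix `Φ ∈ ℝ^{(n1-1)×(n2-1)}` with entries (for `i ∈ {1,…,n1-1}`,
`j ∈ {1,…,n2-1}`, here represented by Fin indices shifted by one)
`Φ_{i,j} = √(log n1 · log n2) · min{(√i ∧ √(n1-i))(√j ∧ √(n2-j)), √(n1 n2 / k)}`. -/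
def PhiMat (m1 m2 k : ℕ) : Matrix (Fin (m1+1)) (Fin (m2+1)) ℝ :=
  Matrix.of fun a b =>
    Real.sqrt (Real.log ((m1:ℝ) + 2) * Real.log ((m2:ℝ) + 2)) *
      min (min (Real.sqrt ((a:ℝ) + 1)) (Real.sqrt (((m1:ℝ) + 2) - ((a:ℝ) + 1))) *
           min (Real.sqrt ((b:ℝ) + 1)) (Real.sqrt (((m2:ℝ) + 2) - ((b:ℝ) + 1))))
        (Real.sqrt ((((m1:ℝ) + 2) * ((m2:ℝ) + 2)) / (k:ℝ)))

/-- The squared mixed second difference of `(p, q) ↦ min (√p * √q) T` over a unit cell. -/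
def truncCellSq (T : ℝ) (p q : ℕ) : ℝ :=
  (min (√((p : ℝ) + 1) * √((q : ℝ) + 1)) T - min (√(p : ℝ) * √((q : ℝ) + 1)) T
    - min (√((p : ℝ) + 1) * √(q : ℝ)) T + min (√(p : ℝ) * √(q : ℝ)) T) ^ 2

lemma truncCellSq_comm (T : ℝ) (p q : ℕ) : truncCellSq T p q = truncCellSq T q p := by
  unfold truncCellSq
  rw [mul_comm √((p : ℝ) + 1) √((q : ℝ) + 1), mul_comm √(p : ℝ) √((q : ℝ) + 1),
    mul_comm √((p : ℝ) + 1) √(q : ℝ), mul_comm √(p : ℝ) √(q : ℝ)]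
  ring

lemma truncCellSq_nonneg (T : ℝ) (p q : ℕ) : 0 ≤ truncCellSq T p q := sq_nonneg _

lemma sqrt_succ_sub_sqrt_le (q : ℕ) : √((q : ℝ) + 1) - √(q : ℝ) ≤ 1 / √((q : ℝ) + 1) := by
  have h1 : 0 < √((q : ℝ) + 1) := by positivity
  have h2 : √(q : ℝ) ≤ √((q : ℝ) + 1) := Real.sqrt_le_sqrt (by linarith)
  rw [le_div_iff₀ h1]
  have h3 := Real.sq_sqrt (show (0 : ℝ) ≤ (q : ℝ) + 1 by positivity)
  have h4 := Real.sq_sqrt (show (0 : ℝ) ≤ (q : ℝ) by positivity)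
  nlinarith [Real.sqrt_nonneg (q : ℝ)]

lemma sqrt_le_sqrt_succ (q : ℕ) : √(q : ℝ) ≤ √((q : ℝ) + 1) :=
  Real.sqrt_le_sqrt (by linarith)

lemma min_sub_min_le_sub {x y : ℝ} (T : ℝ) (h : x ≤ y) : min y T - min x T ≤ y - x := by
  rcases min_cases y T with ⟨h1, _⟩ | ⟨h1, _⟩ <;> rcases min_cases x T with ⟨h2, _⟩ | ⟨h2, _⟩ <;>
    rw [h1, h2] <;> linarith

lemma truncCellSq_le_div (T : ℝ) (p q : ℕ) :
    truncCellSq T p q ≤ ((p : ℝ) + 1) / ((q : ℝ) + 1) := by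
  have hp := sqrt_le_sqrt_succ p
  have hq := sqrt_le_sqrt_succ q
  have hp0 := Real.sqrt_nonneg (p : ℝ)
  have hd := sqrt_succ_sub_sqrt_le q
  have hA := mul_le_mul_of_nonneg_left hq (hp0.trans hp)
  have hB := mul_le_mul_of_nonneg_left hq hp0
  have hA1 := min_sub_min_le_sub T hA
  have hB1 := min_sub_min_le_sub T hB
  have hA0 := min_le_min_right T hA
  have hB0 := min_le_min_right T hB
  have hle : √((p : ℝ) + 1) * √((q : ℝ) + 1) - √((p : ℝ) + 1) * √(q : ℝ)
      ≤ √((p : ℝ) + 1) * (1 / √((q : ℝ) + 1)) := by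
    rw [← mul_sub]; exact mul_le_mul_of_nonneg_left hd (hp0.trans hp)
  have hle' : √(p : ℝ) * √((q : ℝ) + 1) - √(p : ℝ) * √(q : ℝ)
      ≤ √((p : ℝ) + 1) * (1 / √((q : ℝ) + 1)) := by
    rw [← mul_sub]; exact mul_le_mul hp hd (by linarith) (hp0.trans hp)
  have hsq : ((p : ℝ) + 1) / ((q : ℝ) + 1) = (√((p : ℝ) + 1) * (1 / √((q : ℝ) + 1))) ^ 2 := by
    rw [mul_pow, div_pow, Real.sq_sqrt (by positivity), Real.sq_sqrt (by positivity)]; ring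
  rw [hsq]
  unfold truncCellSq
  apply sq_le_sq'
  · linarith
  · linarith

lemma truncCellSq_of_le {T : ℝ} {p q : ℕ} (h : √((p : ℝ) + 1) * √((q : ℝ) + 1) ≤ T) :
    truncCellSq T p q ≤ 1 / ((p : ℝ) + 1) * (1 / ((q : ℝ) + 1)) := by
  have hp := sqrt_le_sqrt_succ p
  have hq := sqrt_le_sqrt_succ q
  have hp0 := Real.sqrt_nonneg (p : ℝ)
  have hq0 := Real.sqrt_nonneg (q : ℝ)
  have h1 : √(p : ℝ) * √((q : ℝ) + 1) ≤ T := le_trans (by gcongr) h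
  have h2 : √((p : ℝ) + 1) * √(q : ℝ) ≤ T := le_trans (by gcongr) h
  have h3 : √(p : ℝ) * √(q : ℝ) ≤ T := le_trans (by gcongr) h1
  unfold truncCellSq
  rw [min_eq_left h, min_eq_left h1, min_eq_left h2, min_eq_left h3]
  have hs : ∀ r : ℕ, (√((r : ℝ) + 1) - √(r : ℝ)) ^ 2 ≤ 1 / ((r : ℝ) + 1) := fun r => by
    have := pow_le_pow_left₀ (sub_nonneg.2 (sqrt_le_sqrt_succ r)) (sqrt_succ_sub_sqrt_le r) 2
    rwa [div_pow, Real.sq_sqrt (by positivity), one_pow] at this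
  calc _ = (√((p : ℝ) + 1) - √(p : ℝ)) ^ 2 * (√((q : ℝ) + 1) - √(q : ℝ)) ^ 2 := by ring
    _ ≤ _ := mul_le_mul (hs p) (hs q) (sq_nonneg _) (by positivity)

lemma truncCellSq_of_ge {T : ℝ} {p q : ℕ} (h : T ≤ √(p : ℝ) * √(q : ℝ)) :
    truncCellSq T p q = 0 := by
  have hp := sqrt_le_sqrt_succ p
  have hq := sqrt_le_sqrt_succ q
  have h1 : T ≤ √(p : ℝ) * √((q : ℝ) + 1) := h.trans (by gcongr)
  have h2 : T ≤ √((p : ℝ) + 1) * √(q : ℝ) := h.trans (by gcongr)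
  have h3 : T ≤ √((p : ℝ) + 1) * √((q : ℝ) + 1) := h1.trans (by gcongr)
  unfold truncCellSq
  rw [min_eq_right h, min_eq_right h1, min_eq_right h2, min_eq_right h3]
  ring

/-- The weight of a cell `(p, q)` with `1 ≤ p ≤ q` that is crossed by the hyperbola `x y = T²`. -/
def crossWeight (T : ℝ) (p q : ℕ) : ℝ :=
  if 1 ≤ p ∧ p ≤ q ∧ (p : ℝ) * q < T ^ 2 ∧ T ^ 2 < ((p : ℝ) + 1) * ((q : ℝ) + 1)
  then ((p : ℝ) + 1) / ((q : ℝ) + 1) else 0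

lemma crossWeight_nonneg (T : ℝ) (p q : ℕ) : 0 ≤ crossWeight T p q := by
  unfold crossWeight; split_ifs <;> positivity

lemma truncCellSq_le {T : ℝ} (hT : 0 ≤ T) (p q : ℕ) :
    truncCellSq T p q ≤
      1 / ((p : ℝ) + 1) * (1 / ((q : ℝ) + 1)) + crossWeight T p q + crossWeight T q p := by
  have c1 := crossWeight_nonneg T p q
  have c2 := crossWeight_nonneg T q p
  have hpos : (0 : ℝ) ≤ 1 / ((p : ℝ) + 1) * (1 / ((q : ℝ) + 1)) := by positivity
  rcases Nat.eq_zero_or_pos p with rfl | hp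
  · have := truncCellSq_le_div T 0 q
    simp only [Nat.cast_zero, zero_add, div_one, one_mul] at this ⊢
    linarith
  rcases Nat.eq_zero_or_pos q with rfl | hq
  · have := truncCellSq_le_div T 0 p
    rw [truncCellSq_comm] at this
    simp only [Nat.cast_zero, zero_add, div_one, mul_one] at this ⊢
    linarith
  by_cases h1 : √((p : ℝ) + 1) * √((q : ℝ) + 1) ≤ T
  · linarith [truncCellSq_of_le h1]
  by_cases h2 : T ≤ √(p : ℝ) * √(q : ℝ)
  · linarith [truncCellSq_of_ge h2]
  rw [not_le, ← Real.sqrt_mul (by positivity), Real.lt_sqrt hT] at h1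
  have hT' : 0 < T := lt_of_le_of_lt (by positivity) (not_le.1 h2)
  rw [not_le, ← Real.sqrt_mul (by positivity), Real.sqrt_lt' hT'] at h2
  rcases le_total p q with h | h
  · have : crossWeight T p q = ((p : ℝ) + 1) / ((q : ℝ) + 1) := if_pos ⟨hp, h, h2, h1⟩
    linarith [truncCellSq_le_div T p q]
  · have : crossWeight T q p = ((q : ℝ) + 1) / ((p : ℝ) + 1) :=
      if_pos ⟨hq, h, by rwa [mul_comm], by rwa [mul_comm]⟩
    have h3 := truncCellSq_le_div T q p
    rw [truncCellSq_comm] at h3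
    linarith

lemma sum_crossWeight_row_le {T : ℝ} {p : ℕ} (hp : 1 ≤ p) (hpT : (p : ℝ) ≤ T) (N : ℕ) :
    ∑ q ∈ Finset.range N, crossWeight T p q ≤ 10 := by
  have hp1 : (1 : ℝ) ≤ p := by exact_mod_cast hp
  have hT : 0 < T := by linarith
  set a : ℝ := T ^ 2 / ((p : ℝ) + 1) with ha
  set b : ℝ := T ^ 2 / (p : ℝ) with hb
  have ha0 : 0 < a := by positivity
  have hb0 : 0 < b := by positivity
  set S := (Finset.range N).filter fun q : ℕ => (p : ℝ) * q < T ^ 2 ∧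
    T ^ 2 < ((p : ℝ) + 1) * ((q : ℝ) + 1) with hS
  have hcard : (S.card : ℝ) ≤ b - a + 2 := by
    have hab : a ≤ b := div_le_div_of_nonneg_left (by positivity) (by linarith) (by linarith)
    have hsub : S.image Nat.succ ⊆ Finset.Ioc ⌊a⌋₊ ⌊b + 1⌋₊ := by
      intro r hr
      obtain ⟨q, hq, rfl⟩ := Finset.mem_image.1 hr
      obtain ⟨-, h1, h2⟩ := Finset.mem_filter.1 hq
      rw [Finset.mem_Ioc, Nat.floor_lt ha0.le, Nat.le_floor_iff (by positivity)]
      push_cast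
      constructor
      · rw [ha, div_lt_iff₀ (by positivity)]; linarith
      · have : (q : ℝ) ≤ b := by rw [hb, le_div_iff₀ (by positivity)]; linarith
        linarith
    have h1 := Finset.card_le_card hsub
    rw [Finset.card_image_of_injective _ Nat.succ_injective, Nat.card_Ioc] at h1
    have h2 : ⌊a⌋₊ ≤ ⌊b + 1⌋₊ := Nat.floor_mono (by linarith)
    have h3 : (S.card : ℝ) ≤ (⌊b + 1⌋₊ : ℝ) - ⌊a⌋₊ := by
      rw [← Nat.cast_sub h2]; exact_mod_cast h1
    have h4 := Nat.floor_le (show 0 ≤ b + 1 by positivity)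
    have h5 := Nat.lt_floor_add_one a
    linarith
  have hsum : ∑ q ∈ Finset.range N, crossWeight T p q ≤ S.card * (((p : ℝ) + 1) ^ 2 / T ^ 2) := by
    rw [← nsmul_eq_mul, ← Finset.sum_const, hS, Finset.sum_filter]
    apply Finset.sum_le_sum
    intro q _
    unfold crossWeight
    split_ifs with h1 h2 h2
    · rw [div_le_div_iff₀ (by positivity) (by positivity)]
      nlinarith [h2.2]
    · exact absurd h1.2.2 h2
    · positivity
    · exact le_rfl
  refine hsum.trans ((mul_le_mul_of_nonneg_right hcard (by positivity)).trans ?_)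
  have h1 : (b - a) * (((p : ℝ) + 1) ^ 2 / T ^ 2) = ((p : ℝ) + 1) / p := by
    rw [ha, hb]; field_simp; ring
  have h2 : ((p : ℝ) + 1) / p ≤ 2 := by rw [div_le_iff₀ (by linarith)]; linarith
  have h3 : ((p : ℝ) + 1) ^ 2 / T ^ 2 ≤ 4 := by
    rw [div_le_iff₀ (by positivity)]; nlinarith
  rw [add_mul, h1]
  linarith

lemma sum_crossWeight_le {T : ℝ} (hT : 0 ≤ T) (M N : ℕ) :
    ∑ p ∈ Finset.range M, ∑ q ∈ Finset.range N, crossWeight T p q ≤ 10 * T := by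
  have hrow : ∀ p ∈ Finset.range M, ∑ q ∈ Finset.range N, crossWeight T p q ≤
      if p ∈ Finset.Icc 1 ⌊T⌋₊ then 10 else 0 := by
    intro p _
    split_ifs with h
    · rw [Finset.mem_Icc, Nat.le_floor_iff hT] at h
      exact sum_crossWeight_row_le h.1 h.2 N
    · rw [Finset.mem_Icc, Nat.le_floor_iff hT] at h
      refine (Finset.sum_eq_zero fun q _ => if_neg ?_).le
      rintro ⟨h1, h2, h3, -⟩
      refine h ⟨h1, ?_⟩
      have h2' : (p : ℝ) ≤ q := by exact_mod_cast h2
      exact le_of_sq_le_sq (by nlinarith [(Nat.cast_nonneg p : (0 : ℝ) ≤ p)]) hT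
  refine (Finset.sum_le_sum hrow).trans ?_
  rw [← Finset.sum_filter, Finset.sum_const, nsmul_eq_mul]
  have hc : ((Finset.range M).filter (· ∈ Finset.Icc 1 ⌊T⌋₊)).card ≤ ⌊T⌋₊ := by
    refine (Finset.card_le_card fun x hx => (Finset.mem_filter.1 hx).2).trans ?_
    simp
  have : (((Finset.range M).filter (· ∈ Finset.Icc 1 ⌊T⌋₊)).card : ℝ) ≤ T :=
    le_trans (by exact_mod_cast hc) (Nat.floor_le hT)
  linarith

lemma sum_one_div_succ_le (m : ℕ) :
    ∑ p ∈ Finset.range (m + 2), 1 / ((p : ℝ) + 1) ≤ 3 * Real.log ((m : ℝ) + 2) := by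
  have h := harmonic_le_one_add_log (m + 2)
  have h2 : Real.log 2 ≤ Real.log ((m : ℝ) + 2) := Real.log_le_log (by norm_num) (by simp)
  have h3 := Real.log_two_gt_d9
  simp only [harmonic, Rat.cast_sum] at h
  push_cast at h
  simp only [one_div]
  linarith

lemma sum_truncCellSq_le {T : ℝ} (hT : 0 ≤ T) (m1 m2 : ℕ) :
    ∑ p ∈ Finset.range (m1 + 2), ∑ q ∈ Finset.range (m2 + 2), truncCellSq T p q ≤
      20 * T + 9 * (Real.log ((m1 : ℝ) + 2) * Real.log ((m2 : ℝ) + 2)) := by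
  have h0 := Finset.sum_le_sum fun p (_ : p ∈ Finset.range (m1 + 2)) =>
    Finset.sum_le_sum fun q (_ : q ∈ Finset.range (m2 + 2)) => truncCellSq_le hT p q
  simp only [Finset.sum_add_distrib] at h0
  rw [← Finset.sum_mul_sum] at h0
  have h1 := sum_crossWeight_le hT (m1 + 2) (m2 + 2)
  have h2 := sum_crossWeight_le hT (m2 + 2) (m1 + 2)
  rw [Finset.sum_comm] at h2
  have h3 := mul_le_mul (sum_one_div_succ_le m1) (sum_one_div_succ_le m2)
    (Finset.sum_nonneg fun _ _ => by positivity)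
    (mul_nonneg (by norm_num) (Real.log_nonneg (by linarith [(Nat.cast_nonneg m1 : (0 : ℝ) ≤ m1)])))
  linarith

lemma sum_reflect_min_le {G : ℕ → ℝ} (hG : ∀ i, 0 ≤ G i) (n : ℕ) :
    ∑ i ∈ Finset.range n, G (min i (n - 1 - i)) ≤ 2 * ∑ i ∈ Finset.range n, G i := by
  have h : ∑ i ∈ Finset.range n, G (min i (n - 1 - i)) ≤
      ∑ i ∈ Finset.range n, (G i + G (n - 1 - i)) := by
    refine Finset.sum_le_sum fun i _ => ?_
    rcases min_choice i (n - 1 - i) with h | h <;> rw [h] <;> linarith [hG i, hG (n - 1 - i)]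
  rw [Finset.sum_add_distrib, Finset.sum_range_reflect] at h
  linarith

lemma sum_diffMat_mul (m : ℕ) (φ : ℕ → ℝ) (h0 : φ 0 = 0) (h1 : φ (m + 2) = 0) (i : Fin (m + 2)) :
    ∑ a : Fin (m + 1), diffMat m a i * φ ((a : ℕ) + 1) = φ i - φ ((i : ℕ) + 1) := by
  have hterm : ∀ a : Fin (m + 1), diffMat m a i * φ ((a : ℕ) + 1) =
      (if (a : ℕ) + 1 = i then φ i else 0) - (if (a : ℕ) = i then φ ((i : ℕ) + 1) else 0) := by
    intro a
    simp only [diffMat, Matrix.of_apply, Fin.ext_iff, Fin.val_castSucc, Fin.val_succ]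
    by_cases h : (i : ℕ) = a
    · simp [h]
    by_cases h' : (i : ℕ) = a + 1
    · simp [h']
    · simp [h, h', Ne.symm h, Ne.symm h']
  rw [Finset.sum_congr rfl fun a _ => hterm a, Finset.sum_sub_distrib,
    Fin.sum_univ_eq_sum_range (fun a : ℕ => if a + 1 = (i : ℕ) then φ i else 0),
    Fin.sum_univ_eq_sum_range (fun a : ℕ => if a = (i : ℕ) then φ ((i : ℕ) + 1) else 0)]
  obtain ⟨i, hi⟩ := i
  congr 1
  · cases i with
    | zero => simp [h0]
    | succ i => simp; omega
  · rw [Finset.sum_ite_eq']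
    simp only [Finset.mem_range]
    split_ifs with h
    · rfl
    · rw [show i + 1 = m + 2 by omega, h1]

/-- The one-dimensional profile `√i ∧ √(n - i)`. -/
def tent (m i : ℕ) : ℝ := min √(i : ℝ) √((m : ℝ) + 2 - i)

lemma tent_zero (m : ℕ) : tent m 0 = 0 := by simp [tent, Real.sqrt_nonneg]

lemma tent_last (m : ℕ) : tent m (m + 2) = 0 := by simp [tent, Real.sqrt_nonneg]

lemma tent_eq_sqrt (m i : ℕ) (hi : i ≤ m + 2) : tent m i = √((min i (m + 2 - i) : ℕ) : ℝ) := by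
  rw [tent, Nat.cast_min, Nat.cast_sub hi, Real.sqrt_monotone.map_min]
  push_cast
  rfl

lemma tent_cell (m i : ℕ) (hi : i < m + 2) :
    (tent m i = √((min i (m + 2 - 1 - i) : ℕ) : ℝ) ∧
      tent m (i + 1) = √(((min i (m + 2 - 1 - i) : ℕ) : ℝ) + 1)) ∨
    (tent m i = √(((min i (m + 2 - 1 - i) : ℕ) : ℝ) + 1) ∧
      tent m (i + 1) = √((min i (m + 2 - 1 - i) : ℕ) : ℝ)) ∨
    tent m i = tent m (i + 1) := by
  rw [tent_eq_sqrt m i hi.le, tent_eq_sqrt m (i + 1) hi, ← Nat.cast_succ]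
  rcases lt_trichotomy (2 * i + 1) (m + 2) with h | h | h
  · left; constructor <;> congr 2 <;> omega
  · right; right; congr 2; omega
  · right; left; constructor <;> congr 2 <;> omega

lemma entry_eq (m1 m2 k : ℕ) (i : Fin (m1 + 2)) (j : Fin (m2 + 2)) :
    ((diffMat m1)ᵀ * PhiMat m1 m2 k * diffMat m2) i j =
      √(Real.log ((m1 : ℝ) + 2) * Real.log ((m2 : ℝ) + 2)) *
        (min (tent m1 i * tent m2 j) √(((m1 : ℝ) + 2) * ((m2 : ℝ) + 2) / k)
        - min (tent m1 (i + 1) * tent m2 j) √(((m1 : ℝ) + 2) * ((m2 : ℝ) + 2) / k)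
        - min (tent m1 i * tent m2 (j + 1)) √(((m1 : ℝ) + 2) * ((m2 : ℝ) + 2) / k)
        + min (tent m1 (i + 1) * tent m2 (j + 1)) √(((m1 : ℝ) + 2) * ((m2 : ℝ) + 2) / k)) := by
  set T := √(((m1 : ℝ) + 2) * ((m2 : ℝ) + 2) / k) with hTdef
  have hT : 0 ≤ T := Real.sqrt_nonneg _
  set c := √(Real.log ((m1 : ℝ) + 2) * Real.log ((m2 : ℝ) + 2)) with hc
  have hΦ : ∀ a b, PhiMat m1 m2 k a b =
      c * min (tent m1 ((a : ℕ) + 1) * tent m2 ((b : ℕ) + 1)) T := by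
    intro a b
    simp [PhiMat, tent, hTdef, hc]
  have hrow : ∀ b, ((diffMat m1)ᵀ * PhiMat m1 m2 k) i b =
      c * min (tent m1 i * tent m2 ((b : ℕ) + 1)) T
        - c * min (tent m1 (i + 1) * tent m2 ((b : ℕ) + 1)) T := by
    intro b
    rw [Matrix.mul_apply]
    simp only [Matrix.transpose_apply, hΦ]
    exact sum_diffMat_mul m1 (fun a => c * min (tent m1 a * tent m2 ((b : ℕ) + 1)) T)
      (by simp [tent_zero, hT]) (by simp [tent_last, hT]) i
  rw [Matrix.mul_apply]
  simp only [hrow]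
  rw [Finset.sum_congr rfl fun b _ => mul_comm _ _]
  rw [sum_diffMat_mul m2 (fun b => c * min (tent m1 i * tent m2 b) T
        - c * min (tent m1 (i + 1) * tent m2 b) T)
      (by simp [tent_zero, hT]) (by simp [tent_last, hT]) j]
  ring

lemma entry_sq_le (m1 m2 k : ℕ) (i : Fin (m1 + 2)) (j : Fin (m2 + 2)) :
    (((diffMat m1)ᵀ * PhiMat m1 m2 k * diffMat m2) i j) ^ 2 ≤
      Real.log ((m1 : ℝ) + 2) * Real.log ((m2 : ℝ) + 2) *
        truncCellSq √(((m1 : ℝ) + 2) * ((m2 : ℝ) + 2) / k)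
          (min (i : ℕ) (m1 + 2 - 1 - i)) (min (j : ℕ) (m2 + 2 - 1 - j)) := by
  have hl : ∀ m : ℕ, 0 ≤ Real.log ((m : ℝ) + 2) := fun m =>
    Real.log_nonneg (by linarith [(Nat.cast_nonneg m : (0 : ℝ) ≤ m)])
  rw [entry_eq, mul_pow, Real.sq_sqrt (mul_nonneg (hl m1) (hl m2))]
  refine mul_le_mul_of_nonneg_left ?_ (mul_nonneg (hl m1) (hl m2))
  have hF := truncCellSq_nonneg √(((m1 : ℝ) + 2) * ((m2 : ℝ) + 2) / k)
    (min (i : ℕ) (m1 + 2 - 1 - i)) (min (j : ℕ) (m2 + 2 - 1 - j))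
  rcases tent_cell m1 i i.2 with ⟨h1, h2⟩ | ⟨h1, h2⟩ | h1
  · rcases tent_cell m2 j j.2 with ⟨h3, h4⟩ | ⟨h3, h4⟩ | h3
    · rw [h1, h2, h3, h4, truncCellSq]; apply le_of_eq; ring
    · rw [h1, h2, h3, h4, truncCellSq]; apply le_of_eq; ring
    · rw [h3]; refine le_trans (le_of_eq ?_) hF; ring
  · rcases tent_cell m2 j j.2 with ⟨h3, h4⟩ | ⟨h3, h4⟩ | h3
    · rw [h1, h2, h3, h4, truncCellSq]; apply le_of_eq; ring
    · rw [h1, h2, h3, h4, truncCellSq]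
    · rw [h3]; refine le_trans (le_of_eq ?_) hF; ring
  · rw [h1]; refine le_trans (le_of_eq ?_) hF; ring

/-- Lemma 5.4: `‖Dᵀ Φ D̃‖_F² ≤ C (log n1 · log n2 · √(n1 n2/k) + (log n1)² (log n2)²)`. -/
theorem frobSq_D_Phi_D_bound :
    ∃ C : ℝ, 0 < C ∧
      ∀ (m1 m2 k : ℕ), 1 ≤ k →
        frobSq ((diffMat m1)ᵀ * PhiMat m1 m2 k * diffMat m2)
          ≤ C * (Real.log ((m1:ℝ) + 2) * Real.log ((m2:ℝ) + 2) *
                Real.sqrt ((((m1:ℝ) + 2) * ((m2:ℝ) + 2)) / (k:ℝ)) +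
              (Real.log ((m1:ℝ) + 2)) ^ 2 * (Real.log ((m2:ℝ) + 2)) ^ 2) := by
  refine ⟨80, by norm_num, fun m1 m2 k _ => ?_⟩
  have hl : ∀ m : ℕ, 0 ≤ Real.log ((m : ℝ) + 2) := fun m =>
    Real.log_nonneg (by linarith [(Nat.cast_nonneg m : (0 : ℝ) ≤ m)])
  set T := √(((m1 : ℝ) + 2) * ((m2 : ℝ) + 2) / k)
  have hT : 0 ≤ T := Real.sqrt_nonneg _
  set L := Real.log ((m1 : ℝ) + 2) * Real.log ((m2 : ℝ) + 2) with hL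
  have hL0 : 0 ≤ L := mul_nonneg (hl m1) (hl m2)
  have h1 : frobSq ((diffMat m1)ᵀ * PhiMat m1 m2 k * diffMat m2) ≤
      L * ∑ i ∈ Finset.range (m1 + 2), ∑ j ∈ Finset.range (m2 + 2),
        truncCellSq T (min i (m1 + 2 - 1 - i)) (min j (m2 + 2 - 1 - j)) := by
    rw [← Fin.sum_univ_eq_sum_range fun i => ∑ j ∈ Finset.range (m2 + 2),
      truncCellSq T (min i (m1 + 2 - 1 - i)) (min j (m2 + 2 - 1 - j)), frobSq, Finset.mul_sum]
    refine Finset.sum_le_sum fun i _ => ?_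
    rw [← Fin.sum_univ_eq_sum_range fun j =>
      truncCellSq T (min (i : ℕ) (m1 + 2 - 1 - i)) (min j (m2 + 2 - 1 - j)), Finset.mul_sum]
    exact Finset.sum_le_sum fun j _ => entry_sq_le m1 m2 k i j
  have h2 := sum_reflect_min_le (G := fun p => ∑ j ∈ Finset.range (m2 + 2),
    truncCellSq T p (min j (m2 + 2 - 1 - j)))
    (fun p => Finset.sum_nonneg fun _ _ => truncCellSq_nonneg _ _ _) (m1 + 2)
  have h3 := Finset.sum_le_sum fun p (_ : p ∈ Finset.range (m1 + 2)) =>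
    sum_reflect_min_le (truncCellSq_nonneg T p) (m2 + 2)
  rw [← Finset.mul_sum] at h3
  have h4 := sum_truncCellSq_le hT m1 m2
  rw [← hL] at h4
  refine h1.trans ((mul_le_mul_of_nonneg_left (show _ ≤ 80 * T + 36 * L by linarith) hL0).trans ?_)
  rw [← mul_pow, ← hL]
  nlinarith
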